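/- Let r ≥ 2, let P be a hereditary property of r-graphs containing graphs of arbitrarily large order, and let 1 ≤ α ≤ β. Then (λ^(β)(P))^β ≤ (λ^(α)(P))^α · (π(P))^{β−α}; in particular, if π(P) > 0, then (λ^(β)(P)/π(P))^β ≤ (λ^(α)(P)/π(P))^α. -/

import Mathlib

/-!
Common definitions: `r`-uniform hypergraphs on vertex set `Fin n`, the polyform,
the parameter `λ^(α)`, degrees, properties of `r`-graphs, blow-ups, extremal
numbers and chromatic numbers.
-/

open Finset

/-- An `r`-uniform hypergraph on the vertex set `Fin n`. -/
structure HGraph (r n : ℕ) where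
  edges : Finset (Finset (Fin n))
  uniform : ∀ e ∈ edges, e.card = r

namespace HGraph

/-- The polyform `P_G(x) = r! ∑_{e ∈ E(G)} ∏_{i ∈ e} x_i`. -/
noncomputable def polyform {r n : ℕ} (G : HGraph r n) (x : Fin n → ℝ) : ℝ :=
  (r.factorial : ℝ) * ∑ e ∈ G.edges, ∏ i ∈ e, x i

/-- `λ^(α)(G)`: the maximum of the polyform over the unit sphere of `ℓ^α`. -/
noncomputable def lam {r n : ℕ} (α : ℝ) (G : HGraph r n) : ℝ :=
  sSup {y : ℝ | ∃ x : Fin n → ℝ, (∑ i, |x i| ^ α) = 1 ∧ y = G.polyform x}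

/-- The degree of a vertex: the number of edges containing it. -/
def degree {r n : ℕ} (G : HGraph r n) (v : Fin n) : ℕ :=
  (G.edges.filter (fun e => v ∈ e)).card

/-- Maximum degree `Δ(G)`. -/
def maxDeg {r n : ℕ} (G : HGraph r n) : ℕ :=
  Finset.univ.sup G.degree

/-- Minimum degree `δ(G)`. -/
noncomputable def minDeg {r n : ℕ} (G : HGraph r n) : ℕ :=
  sInf (Set.range G.degree)

/-- `G` is regular if all vertices have equal degrees. -/
def Regular {r n : ℕ} (G : HGraph r n) : Prop :=
  ∀ u v : Fin n, G.degree u = G.degree v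

/-- The induced subgraph of `G` along the embedding `f`. -/
def induce {r n m : ℕ} (G : HGraph r n) (f : Fin m ↪ Fin n) : HGraph r m where
  edges := Finset.univ.filter (fun e : Finset (Fin m) => e.map f ∈ G.edges)
  uniform := by
    intro e he
    rw [Finset.mem_filter] at he
    have h2 := G.uniform _ he.2
    rwa [Finset.card_map] at h2

/-- A property of `r`-graphs: a family closed under isomorphism (relabeling). -/
def IsProperty {r : ℕ} (P : ∀ n, Set (HGraph r n)) : Prop :=
  ∀ n : ℕ, ∀ σ : Equiv.Perm (Fin n), ∀ G ∈ P n, G.induce σ.toEmbedding ∈ P n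

/-- A hereditary property: closed under taking induced subgraphs. -/
def Hereditary {r : ℕ} (P : ∀ n, Set (HGraph r n)) : Prop :=
  ∀ n m : ℕ, ∀ f : Fin m ↪ Fin n, ∀ G ∈ P n, G.induce f ∈ P m

/-- A monotone property: closed under taking subgraphs. -/
def MonotoneProp {r : ℕ} (P : ∀ n, Set (HGraph r n)) : Prop :=
  ∀ n m : ℕ, ∀ f : Fin m ↪ Fin n, ∀ G ∈ P n, ∀ H : HGraph r m,
    (∀ e ∈ H.edges, e.map f ∈ G.edges) → H ∈ P m

/-- `B`, together with the projection `φ : V(B) → V(G)`, is (a copy of) the blow-up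
`G(k 1, …, k n)` of `G`: the fiber over a vertex `i` of `G` has `k i` vertices, and the
edges of `B` are exactly the transversals of the classes corresponding to edges of `G`. -/
def IsBlowup {r n N : ℕ} (G : HGraph r n) (k : Fin n → ℕ)
    (B : HGraph r N) (φ : Fin N → Fin n) : Prop :=
  (∀ i : Fin n, (Finset.univ.filter (fun v => φ v = i)).card = k i) ∧
  ∀ s : Finset (Fin N), s ∈ B.edges ↔ (Set.InjOn φ ↑s ∧ s.image φ ∈ G.edges)

/-- A multiplicative property: contains all blow-ups of all of its members. -/
def MultiplicativeProp {r : ℕ} (P : ∀ n, Set (HGraph r n)) : Prop :=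
  ∀ n : ℕ, ∀ G ∈ P n, ∀ k : Fin n → ℕ, (∀ i, 0 < k i) →
    ∀ N : ℕ, ∀ B : HGraph r N, ∀ φ : Fin N → Fin n, IsBlowup G k B φ → B ∈ P N

/-- The extremal number `ex(P, n)`: the maximum number of edges of a member of `P`
of order `n`. -/
noncomputable def exP {r : ℕ} (P : ∀ n, Set (HGraph r n)) (n : ℕ) : ℕ :=
  sSup {m : ℕ | ∃ G ∈ P n, G.edges.card = m}

/-- `λ^(α)(P, n)`: the maximum of `λ^(α)(G)` over members `G` of `P` of order `n`. -/
noncomputable def lamP {r : ℕ} (α : ℝ) (P : ∀ n, Set (HGraph r n)) (n : ℕ) : ℝ :=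
  sSup {y : ℝ | ∃ G ∈ P n, y = lam α G}

/-- The chromatic number: the least `k` such that the vertices can be `k`-colored
with no monochromatic edge (i.e. partitioned into `k` edgeless sets). -/
noncomputable def chrom {r n : ℕ} (G : HGraph r n) : ℕ :=
  sInf {k : ℕ | ∃ c : Fin n → Fin k, ∀ e ∈ G.edges, ¬ ∀ u ∈ e, ∀ w ∈ e, c u = c w}

/-- The weak chromatic number: the least `k` such that the vertices can be `k`-colored
with every edge getting `r` distinct colors (every class meets every edge in ≤ 1 vertex). -/
noncomputable def wchrom {r n : ℕ} (G : HGraph r n) : ℕ :=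
  sInf {k : ℕ | ∃ c : Fin n → Fin k, ∀ e ∈ G.edges, Set.InjOn c ↑e}

/-- `Mon(H)`: the (monotone, hereditary) property of all `r`-graphs containing no
subgraph isomorphic to `H`. -/
def MonP {r h : ℕ} (H : HGraph r h) : ∀ n, Set (HGraph r n) :=
  fun n => {G | ¬ ∃ f : Fin h ↪ Fin n, ∀ e ∈ H.edges, e.map f ∈ G.edges}

end HGraph

namespace HGraph

variable {r n : ℕ}

instance : Finite (HGraph r n) :=
  Finite.of_injective (fun G : HGraph r n => G.edges) fun G H h => by
    cases G; cases H; simpa using h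

/-! ### The polyform and its maximum on the sphere -/

lemma polyform_nonneg (G : HGraph r n) {x : Fin n → ℝ} (hx : ∀ i, 0 ≤ x i) :
    0 ≤ G.polyform x :=
  mul_nonneg (Nat.cast_nonneg _) (sum_nonneg fun _ _ => prod_nonneg fun i _ => hx i)

lemma polyform_le_polyform_abs (G : HGraph r n) (x : Fin n → ℝ) :
    G.polyform x ≤ G.polyform fun i => |x i| := by
  refine mul_le_mul_of_nonneg_left (sum_le_sum fun e _ => ?_) (Nat.cast_nonneg _)
  rw [← abs_prod]
  exact le_abs_self _

lemma polyform_mul (G : HGraph r n) (c : ℝ) (x : Fin n → ℝ) :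
    (G.polyform fun i => c * x i) = c ^ r * G.polyform x := by
  have h : ∀ e ∈ G.edges, ∏ i ∈ e, c * x i = c ^ r * ∏ i ∈ e, x i := fun e he => by
    rw [prod_mul_distrib, prod_const, G.uniform e he]
  rw [polyform, polyform, sum_congr rfl h, ← mul_sum]
  ring

lemma continuous_polyform (G : HGraph r n) : Continuous G.polyform := by
  unfold polyform
  fun_prop

lemma isCompact_sphere {α : ℝ} (hα : 0 < α) :
    IsCompact {x : Fin n → ℝ | ∑ i, |x i| ^ α = 1} := by
  refine Metric.isCompact_of_isClosed_isBounded ?_ ?_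
  · refine isClosed_eq (continuous_finsetSum _ fun i _ => ?_) continuous_const
    exact (Real.continuous_rpow_const hα.le).comp (continuous_apply i).abs
  · refine (Metric.isBounded_closedBall (x := (0 : Fin n → ℝ)) (r := 1)).subset fun x hx => ?_
    rw [mem_closedBall_zero_iff, pi_norm_le_iff_of_nonneg zero_le_one]
    intro i
    have h : |x i| ^ α ≤ 1 := by
      rw [← show ∑ i, |x i| ^ α = 1 from hx]
      exact single_le_sum (f := fun i => |x i| ^ α)
        (fun j _ => Real.rpow_nonneg (abs_nonneg _) _) (mem_univ i)
    rw [Real.norm_eq_abs]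
    by_contra! hlt
    exact absurd h (not_le.2 (Real.one_lt_rpow hlt hα))

lemma lam_eq_sSup_image (α : ℝ) (G : HGraph r n) :
    lam α G = sSup (G.polyform '' {x | ∑ i, |x i| ^ α = 1}) := by
  unfold lam
  congr 1
  ext y
  simp only [Set.mem_ofPred_eq, Set.mem_image, eq_comm]

lemma polyform_le_lam {α : ℝ} (hα : 0 < α) (G : HGraph r n) {x : Fin n → ℝ}
    (hx : ∑ i, |x i| ^ α = 1) : G.polyform x ≤ lam α G := by
  rw [lam_eq_sSup_image]
  exact le_csSup ((isCompact_sphere hα).image G.continuous_polyform).bddAbove ⟨x, hx, rfl⟩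

/-- On a nonempty vertex set, `λ^(α)(G)` is attained at a nonnegative vector. -/
lemma exists_polyform_eq_lam {α : ℝ} (hα : 0 < α) (hn : 0 < n) (G : HGraph r n) :
    ∃ x : Fin n → ℝ, (∀ i, 0 ≤ x i) ∧ ∑ i, x i ^ α = 1 ∧ G.polyform x = lam α G := by
  have hne : {x : Fin n → ℝ | ∑ i, |x i| ^ α = 1}.Nonempty := by
    refine ⟨Pi.single ⟨0, hn⟩ 1, ?_⟩
    rw [Set.mem_ofPred_eq, Fintype.sum_eq_single ⟨0, hn⟩]
    · simp
    · intro i hi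
      simp [Pi.single_eq_of_ne hi, Real.zero_rpow hα.ne']
  obtain ⟨x, hx, hmax⟩ := ((isCompact_sphere hα).image G.continuous_polyform).sSup_mem
    (hne.image _)
  have habs : ∑ i, |(|x i|)| ^ α = 1 := by
    simp only [abs_abs]
    exact hx
  refine ⟨fun i => |x i|, fun i => abs_nonneg _, hx, ?_⟩
  refine le_antisymm (G.polyform_le_lam hα habs) ?_
  rw [lam_eq_sSup_image, ← hmax]
  exact G.polyform_le_polyform_abs x

lemma lam_nonneg {α : ℝ} (hα : 0 < α) (G : HGraph r n) : 0 ≤ lam α G := by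
  rcases Nat.eq_zero_or_pos n with rfl | hn
  · simp [lam]
  · obtain ⟨x, hx, -, h⟩ := G.exists_polyform_eq_lam hα hn
    exact h ▸ G.polyform_nonneg hx

lemma polyform_le_lam_mul {α : ℝ} (hα : 0 < α) (hr : 0 < r) (G : HGraph r n) {x : Fin n → ℝ}
    (hx : ∀ i, 0 ≤ x i) : G.polyform x ≤ lam α G * (∑ i, x i ^ α) ^ ((r : ℝ) / α) := by
  set N := ∑ i, x i ^ α with hN
  have hN0 : 0 ≤ N := sum_nonneg fun i _ => Real.rpow_nonneg (hx i) _
  rcases hN0.eq_or_lt with h0 | hpos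
  · have hx0 : ∀ i, x i = 0 := fun i => by
      have := (sum_eq_zero_iff_of_nonneg fun i _ => Real.rpow_nonneg (hx i) α).1
        (hN.symm.trans h0.symm) i (mem_univ i)
      exact ((Real.rpow_eq_zero (hx i) hα.ne').1 this)
    have h := G.polyform_mul 0 x
    simp only [hx0, mul_zero, zero_pow hr.ne', zero_mul] at h
    rw [show x = fun _ => 0 from funext hx0, h]
    exact mul_nonneg (lam_nonneg hα G) (Real.rpow_nonneg hN0 _)
  · set c := N ^ (1 / α) with hc
    have hcpos : 0 < c := Real.rpow_pos_of_pos hpos _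
    have hcα : c ^ α = N := by
      rw [hc, ← Real.rpow_mul hN0, one_div, inv_mul_cancel₀ hα.ne', Real.rpow_one]
    have hcr : c ^ r = N ^ ((r : ℝ) / α) := by
      rw [hc, ← Real.rpow_natCast, ← Real.rpow_mul hN0]
      congr 1
      ring
    have hsum : ∑ i, |c⁻¹ * x i| ^ α = 1 := by
      have : ∀ i, |c⁻¹ * x i| ^ α = N⁻¹ * x i ^ α := fun i => by
        rw [abs_of_nonneg (mul_nonneg (inv_nonneg.2 hcpos.le) (hx i)),
          Real.mul_rpow (inv_nonneg.2 hcpos.le) (hx i), Real.inv_rpow hcpos.le, hcα]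
      simp only [this]
      rw [← mul_sum, ← hN, inv_mul_cancel₀ hpos.ne']
    have h := G.polyform_le_lam hα hsum
    rw [polyform_mul, inv_pow, hcr, inv_mul_le_iff₀ (Real.rpow_pos_of_pos hpos _)] at h
    linarith

/-! ### Deleting a vertex -/

/-- The edges of `G` avoiding the vertex `k` are the edges of `G - k`. -/
lemma filter_notMem_edges (G : HGraph r (n + 1)) (k : Fin (n + 1)) :
    G.edges.filter (fun e => k ∉ e) =
      (G.induce k.succAboveEmb).edges.map (mapEmbedding k.succAboveEmb).toEmbedding := by
  ext e
  simp only [mem_filter, Finset.mem_map, induce, mem_univ, true_and]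
  constructor
  · rintro ⟨he, hk⟩
    have hsub : (e : Set (Fin (n + 1))) ⊆ Set.range k.succAboveEmb := fun i hi => by
      have : i ≠ k := fun h => hk (h ▸ hi)
      simpa [Fin.range_succAbove] using this
    obtain ⟨f, rfl⟩ : ∃ f : Finset (Fin n), f.map k.succAboveEmb = e := by
      refine ⟨e.preimage k.succAboveEmb k.succAboveEmb.injective.injOn, ?_⟩
      rw [map_eq_image]
      refine (image_preimage _ _ _).trans (filter_true_of_mem fun i hi => hsub hi)
    exact ⟨f, he, rfl⟩
  · rintro ⟨f, hf, rfl⟩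
    exact ⟨hf, by simp [Fin.succAbove_ne]⟩

lemma sum_edges_eq_sum_induce_add (G : HGraph r (n + 1)) (k : Fin (n + 1))
    (w : Finset (Fin (n + 1)) → ℝ) :
    ∑ e ∈ G.edges, w e =
      ∑ e ∈ (G.induce k.succAboveEmb).edges, w (e.map k.succAboveEmb) +
        ∑ e ∈ G.edges with k ∈ e, w e := by
  rw [← sum_filter_add_sum_filter_not G.edges (fun e => k ∈ e), filter_notMem_edges, sum_map,
    add_comm]
  rfl

/-- The polyform is an affine function of each variable, with constant term the polyform of
the graph obtained by deleting the corresponding vertex. -/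
lemma polyform_update (G : HGraph r (n + 1)) (k : Fin (n + 1)) (x : Fin (n + 1) → ℝ) (t : ℝ) :
    G.polyform (Function.update x k t) =
      (G.induce k.succAboveEmb).polyform (fun i => x (k.succAbove i)) +
        t * ((r.factorial : ℝ) * ∑ e ∈ G.edges with k ∈ e, ∏ i ∈ e.erase k, x i) := by
  have h : ∀ e ∈ G.edges.filter (fun e => k ∈ e),
      ∏ i ∈ e, Function.update x k t i = t * ∏ i ∈ e.erase k, x i := fun e he => by
    rw [← mul_prod_erase e _ (mem_filter.1 he).2, Function.update_self]
    congr 1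
    exact prod_congr rfl fun i hi => Function.update_of_ne (ne_of_mem_erase hi) _ _
  rw [polyform, polyform, G.sum_edges_eq_sum_induce_add k, sum_congr rfl h, ← mul_sum]
  simp only [prod_map, Fin.succAboveEmb_apply, Function.update_of_ne (Fin.succAbove_ne k _)]
  ring

lemma one_sub_mul_mul_rpow_le {s y z : ℝ} (hsr : s ≤ r) (hy : 0 ≤ y) (hyz : y ≤ z)
    (hz : z < 1) (hrz : (r : ℝ) * z ≤ 1) (hr : 0 < r) :
    (1 - r * z) * (1 - y) ^ s ≤ (1 - r * y) * (1 - z) ^ s := by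
  have hr1 : (1 : ℝ) ≤ r := by exact_mod_cast hr
  have hy1 : 0 < 1 - y := by linarith
  have hz1 : 0 < 1 - z := by linarith
  have hry : (r : ℝ) * y ≤ 1 := by nlinarith
  set u := (1 - z) / (1 - y) with hu
  have hu0 : 0 < u := div_pos hz1 hy1
  have hu1 : u ≤ 1 := (div_le_one hy1).2 (by linarith)
  have hbern : 1 + r * (u - 1) ≤ u ^ s := by
    have h1 := one_add_mul_le_pow (show -2 ≤ u - 1 by linarith) r
    rw [add_sub_cancel, ← Real.rpow_natCast] at h1
    exact h1.trans (Real.rpow_le_rpow_of_exponent_ge hu0 hu1 hsr)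
  have hus : u ^ s * (1 - y) ^ s = (1 - z) ^ s := by
    rw [← Real.mul_rpow hu0.le hy1.le, hu, div_mul_cancel₀ _ hy1.ne']
  have hu' : u * (1 - y) = 1 - z := by rw [hu, div_mul_cancel₀ _ hy1.ne']
  have key : 1 - r * z ≤ (1 - r * y) * u ^ s := by
    refine le_trans ?_ (mul_le_mul_of_nonneg_left hbern (by linarith))
    have h2 : (1 - u) * (1 - r * y) ≤ (1 - u) * (1 - y) :=
      mul_le_mul_of_nonneg_left (by nlinarith) (by linarith)
    nlinarith
  calc (1 - r * z) * (1 - y) ^ s ≤ (1 - r * y) * u ^ s * (1 - y) ^ s :=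
        mul_le_mul_of_nonneg_right key (Real.rpow_nonneg hy1.le _)
    _ = _ := by rw [mul_assoc, hus]

/-- Deleting a vertex of least weight decreases `λ^(α)` by a controlled factor. -/
lemma exists_lam_le_lam_induce {α : ℝ} (hα : 1 ≤ α) (hr : 0 < r) (hn : 0 < n) (hrn : r ≤ n + 1)
    (G : HGraph r (n + 1)) :
    ∃ k : Fin (n + 1), lam α G * (1 - r * (1 / (n + 1 : ℝ))) ≤
      lam α (G.induce k.succAboveEmb) * (1 - 1 / (n + 1 : ℝ)) ^ ((r : ℝ) / α) := by
  have hα0 : 0 < α := by linarith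
  have hn0 : (0 : ℝ) < n := by exact_mod_cast hn
  obtain ⟨x, hx, hsum, hlam⟩ := G.exists_polyform_eq_lam hα0 n.succ_pos
  obtain ⟨k, -, hk⟩ := exists_min_image univ (fun i => x i ^ α) univ_nonempty
  refine ⟨k, ?_⟩
  set y := x k ^ α with hy
  set z : ℝ := 1 / (n + 1 : ℝ) with hz
  set s : ℝ := (r : ℝ) / α with hs
  set B := (r.factorial : ℝ) * ∑ e ∈ G.edges with k ∈ e, ∏ i ∈ e.erase k, x i with hB
  have hupd := fun t => G.polyform_update k x t
  rw [← hB] at hupd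
  set A := (G.induce k.succAboveEmb).polyform (fun i => x (k.succAbove i)) with hA
  have hy0 : 0 ≤ y := Real.rpow_nonneg (hx k) _
  have hyz : y ≤ z := by
    have h := card_nsmul_le_sum univ (fun i => x i ^ α) y fun i hi => hk i hi
    rw [hsum, card_univ, Fintype.card_fin, nsmul_eq_mul] at h
    rw [hz, le_div_iff₀ (by positivity)]
    push_cast at h
    linarith
  have hz1 : z < 1 := by
    rw [hz, div_lt_one (by positivity)]
    linarith
  have hrz : (r : ℝ) * z ≤ 1 := by
    rw [hz, mul_one_div, div_le_one (by positivity)]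
    exact_mod_cast hrn
  have hsr : s ≤ r := div_le_self (Nat.cast_nonneg _) hα
  have hrest : ∑ i, x (k.succAbove i) ^ α = 1 - y := by
    rw [Fin.sum_univ_succAbove _ k] at hsum
    linarith
  have hA_le : A ≤ lam α (G.induce k.succAboveEmb) * (1 - y) ^ s := by
    rw [← hrest]
    exact (G.induce k.succAboveEmb).polyform_le_lam_mul hα0 hr fun i => hx _
  have hAB : A + x k * B = lam α G := by
    rw [← hupd, Function.update_eq_self, hlam]
  have hA_eq : A = lam α G * (1 - r * y) := by
    rcases (hx k).eq_or_lt with h0 | hpos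
    · have hy' : y = 0 := by rw [hy, ← h0, Real.zero_rpow hα0.ne']
      rw [← h0] at hAB
      rw [hy']
      linarith
    · have hmax : IsLocalMax (fun t : ℝ => A + t * B - lam α G * (1 - y + t ^ α) ^ s) (x k) := by
        filter_upwards [lt_mem_nhds hpos] with t ht
        have h1 : A + x k * B - lam α G * (1 - y + x k ^ α) ^ s = 0 := by
          rw [← hy, sub_add_cancel, Real.one_rpow, hAB]
          ring
        have hx' : ∀ i, 0 ≤ Function.update x k t i := fun i => by
          rcases eq_or_ne i k with rfl | hi
          · simpa using ht.le
          · simpa [Function.update_of_ne hi] using hx i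
        have h2 := G.polyform_le_lam_mul hα0 hr hx'
        rw [hupd, Fin.sum_univ_succAbove _ k] at h2
        simp only [Function.update_self, Function.update_of_ne (Fin.succAbove_ne k _)] at h2
        rw [hrest, add_comm (t ^ α)] at h2
        rw [h1]
        linarith
      have hpow : HasDerivAt (fun t : ℝ => t ^ α) (α * x k ^ (α - 1)) (x k) :=
        Real.hasDerivAt_rpow_const (Or.inl hpos.ne')
      have hbase : 1 - y + x k ^ α = 1 := by rw [← hy, sub_add_cancel]
      have hderiv := (((hasDerivAt_id (x k)).mul_const B).const_add A).sub
        (((hpow.const_add (1 - y)).rpow_const (p := s)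
          (Or.inl (by rw [hbase]; exact one_ne_zero))).const_mul (lam α G))
      have h0 := hmax.hasDerivAt_eq_zero hderiv
      rw [hbase, Real.one_rpow] at h0
      have hxy : x k ^ (α - 1) * x k = y := by
        rw [hy, Real.rpow_sub_one hpos.ne', div_mul_cancel₀ _ hpos.ne']
      have hαs : α * s = r := by rw [hs, mul_div_cancel₀ _ hα0.ne']
      have hxB : x k * B = lam α G * (r * y) := by
        rw [← hxy, ← hαs]
        linear_combination x k * h0
      linarith
  have hpy : 0 < (1 - y) ^ s := Real.rpow_pos_of_pos (by linarith) _
  refine le_of_mul_le_mul_right ?_ hpy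
  calc lam α G * (1 - r * z) * (1 - y) ^ s
      = lam α G * ((1 - r * z) * (1 - y) ^ s) := by ring
    _ ≤ lam α G * ((1 - r * y) * (1 - z) ^ s) :=
        mul_le_mul_of_nonneg_left (one_sub_mul_mul_rpow_le hsr hy0 hyz hz1 hrz hr)
          (lam_nonneg hα0 G)
    _ = A * (1 - z) ^ s := by rw [hA_eq]; ring
    _ ≤ lam α (G.induce k.succAboveEmb) * (1 - y) ^ s * (1 - z) ^ s :=
        mul_le_mul_of_nonneg_right hA_le (Real.rpow_nonneg (by linarith) _)
    _ = _ := by ring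

/-- Double counting of pairs (edge, vertex outside it). -/
lemma sum_card_edges_induce (G : HGraph r (n + 1)) :
    ∑ k : Fin (n + 1), ((G.induce k.succAboveEmb).edges.card : ℝ) =
      (n + 1 - r) * G.edges.card := by
  have h : ∀ k : Fin (n + 1), ((G.induce k.succAboveEmb).edges.card : ℝ) =
      G.edges.card - (G.edges.filter fun e => k ∈ e).card := fun k => by
    have := G.sum_edges_eq_sum_induce_add k fun _ => 1
    simp only [sum_const, nsmul_eq_mul, mul_one] at this
    linarith
  have hdeg : ∑ k : Fin (n + 1), (G.edges.filter fun e => k ∈ e).card = r * G.edges.card := by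
    have hcount := sum_card_bipartiteAbove_eq_sum_card_bipartiteBelow
      (s := (univ : Finset (Fin (n + 1)))) (t := G.edges) (fun k e => k ∈ e)
    refine hcount.trans ?_
    rw [mul_comm, ← smul_eq_mul, ← sum_const]
    exact sum_congr rfl fun e he => by simp [bipartiteBelow, G.uniform e he]
  have hdeg' : ∑ k : Fin (n + 1), ((G.edges.filter fun e => k ∈ e).card : ℝ) =
      r * G.edges.card := by exact_mod_cast hdeg
  simp only [h, sum_sub_distrib, hdeg', sum_const, card_univ, Fintype.card_fin, nsmul_eq_mul]
  push_cast
  ring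

/-! ### Properties of `r`-graphs -/

variable {P : ∀ n, Set (HGraph r n)}

lemma finite_setOf_eq_lam (α : ℝ) (P : ∀ n, Set (HGraph r n)) (n : ℕ) :
    {y : ℝ | ∃ G ∈ P n, y = lam α G}.Finite :=
  (Set.finite_range (lam α : HGraph r n → ℝ)).subset fun _ ⟨G, _, h⟩ => ⟨G, h.symm⟩

lemma lam_le_lamP (α : ℝ) {G : HGraph r n} (hG : G ∈ P n) : lam α G ≤ lamP α P n :=
  le_csSup (finite_setOf_eq_lam α P n).bddAbove ⟨G, hG, rfl⟩

lemma exists_lamP_eq_lam (α : ℝ) (hne : (P n).Nonempty) : ∃ G ∈ P n, lamP α P n = lam α G := by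
  obtain ⟨G, hG⟩ := hne
  have hmem : lam α G ∈ {y : ℝ | ∃ G ∈ P n, y = lam α G} := ⟨G, hG, rfl⟩
  exact Set.Nonempty.csSup_mem ⟨_, hmem⟩ (finite_setOf_eq_lam α P n)

lemma lamP_nonneg {α : ℝ} (hα : 0 < α) (hne : (P n).Nonempty) : 0 ≤ lamP α P n := by
  obtain ⟨G, -, h⟩ := exists_lamP_eq_lam α hne
  exact h ▸ lam_nonneg hα G

lemma finite_setOf_card_edges_eq (P : ∀ n, Set (HGraph r n)) (n : ℕ) :
    {m : ℕ | ∃ G ∈ P n, G.edges.card = m}.Finite :=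
  (Set.finite_range fun G : HGraph r n => G.edges.card).subset fun _ ⟨G, _, h⟩ => ⟨G, h⟩

lemma card_edges_le_exP {G : HGraph r n} (hG : G ∈ P n) : G.edges.card ≤ exP P n :=
  le_csSup (finite_setOf_card_edges_eq P n).bddAbove ⟨G, hG, rfl⟩

lemma exists_card_edges_eq_exP (hne : (P n).Nonempty) : ∃ G ∈ P n, G.edges.card = exP P n := by
  obtain ⟨G, hG⟩ := hne
  have hmem : G.edges.card ∈ {m : ℕ | ∃ G ∈ P n, G.edges.card = m} := ⟨G, hG, rfl⟩
  exact Set.Nonempty.csSup_mem ⟨_, hmem⟩ (finite_setOf_card_edges_eq P n)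

lemma cast_choose_eq (hrn : r ≤ n) :
    (n.choose r : ℝ) * (n + 1) = ((n + 1).choose r : ℝ) * (n + 1 - r) := by
  have h := Nat.choose_mul_succ_eq n r
  have hc : ((n + 1 - r : ℕ) : ℝ) = n + 1 - r := by
    rw [Nat.cast_sub (by omega)]
    push_cast
    ring
  rw [← hc]
  exact_mod_cast h

lemma exP_succ_div_choose_le (hher : Hereditary P) (hne : ∀ n, (P n).Nonempty) (hrn : r ≤ n) :
    (exP P (n + 1) : ℝ) / (n + 1).choose r ≤ (exP P n : ℝ) / n.choose r := by
  obtain ⟨G, hG, hcard⟩ := exists_card_edges_eq_exP (hne (n + 1))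
  have hsum : ((n : ℝ) + 1 - r) * exP P (n + 1) ≤ (n + 1) * exP P n := by
    rw [← hcard, ← sum_card_edges_induce]
    have h := sum_le_card_nsmul univ
      (fun k : Fin (n + 1) => ((G.induce k.succAboveEmb).edges.card : ℝ)) (exP P n)
      fun k _ => by exact_mod_cast card_edges_le_exP (hher _ _ k.succAboveEmb G hG)
    rw [card_univ, Fintype.card_fin, nsmul_eq_mul] at h
    exact_mod_cast h
  have hc : (0 : ℝ) < n.choose r := by exact_mod_cast Nat.choose_pos hrn
  have hc' : (0 : ℝ) < (n + 1).choose r := by exact_mod_cast Nat.choose_pos (by omega)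
  rw [div_le_div_iff₀ hc' hc]
  refine le_of_mul_le_mul_right ?_ (show (0 : ℝ) < n + 1 by positivity)
  calc (exP P (n + 1) : ℝ) * n.choose r * (n + 1)
      = (n + 1).choose r * ((n + 1 - r) * exP P (n + 1)) := by
        rw [mul_assoc, cast_choose_eq hrn]
        ring
    _ ≤ (n + 1).choose r * ((n + 1) * exP P n) := mul_le_mul_of_nonneg_left hsum hc'.le
    _ = _ := by ring

lemma lamP_succ_mul_div_choose_le {α : ℝ} (hα : 1 ≤ α) (hr : 0 < r) (hher : Hereditary P)
    (hne : ∀ n, (P n).Nonempty) (hrn : r ≤ n) :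
    lamP α P (n + 1) * ((n + 1 : ℕ) : ℝ) ^ ((r : ℝ) / α) / (n + 1).choose r ≤
      lamP α P n * (n : ℝ) ^ ((r : ℝ) / α) / n.choose r := by
  obtain ⟨G, hG, hlam⟩ := exists_lamP_eq_lam α (hne (n + 1))
  obtain ⟨k, hk⟩ := G.exists_lam_le_lam_induce hα hr (hr.trans_le hrn) (by omega)
  have hn1 : (0 : ℝ) < n + 1 := by positivity
  have hdiv : 1 - 1 / (n + 1 : ℝ) = n / (n + 1) := by
    field_simp
    ring
  have hstep : lamP α P (n + 1) * (1 - r * (1 / (n + 1 : ℝ))) ≤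
      lamP α P n * (n / (n + 1)) ^ ((r : ℝ) / α) := by
    rw [hlam, ← hdiv]
    refine hk.trans (mul_le_mul_of_nonneg_right (lam_le_lamP α (hher _ _ _ G hG)) ?_)
    rw [hdiv]
    positivity
  rw [Real.div_rpow (Nat.cast_nonneg _) hn1.le,
    ← mul_div_assoc (lamP α P n), le_div_iff₀ (Real.rpow_pos_of_pos hn1 _)] at hstep
  have hc : (0 : ℝ) < n.choose r := by exact_mod_cast Nat.choose_pos hrn
  have hc' : (0 : ℝ) < (n + 1).choose r := by exact_mod_cast Nat.choose_pos (by omega)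
  have hchoose : (n.choose r : ℝ) = (n + 1).choose r * (1 - r * (1 / (n + 1 : ℝ))) := by
    have := cast_choose_eq hrn
    field_simp
    linarith
  rw [div_le_div_iff₀ hc' hc]
  push_cast
  calc lamP α P (n + 1) * (n + 1 : ℝ) ^ ((r : ℝ) / α) * n.choose r
      = lamP α P (n + 1) * (1 - r * (1 / (n + 1 : ℝ))) * (n + 1 : ℝ) ^ ((r : ℝ) / α) *
          (n + 1).choose r := by
        rw [hchoose]
        ring
    _ ≤ _ := mul_le_mul_of_nonneg_right hstep hc'.le

lemma exists_tendsto_of_succ_le {a : ℕ → ℝ} (N : ℕ) (h0 : ∀ n, 0 ≤ a n)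
    (h : ∀ n, N ≤ n → a (n + 1) ≤ a n) : ∃ L, Filter.Tendsto a Filter.atTop (nhds L) := by
  have hanti : Antitone fun n => a (n + N) := antitone_nat_of_succ_le fun n => by
    rw [Nat.add_right_comm]
    exact h _ (Nat.le_add_left _ _)
  refine ⟨_, (Filter.tendsto_add_atTop_iff_nat N).1 (tendsto_atTop_ciInf hanti ⟨0, ?_⟩)⟩
  rintro _ ⟨n, rfl⟩
  exact h0 _

lemma tendsto_choose_div_pow (r : ℕ) :
    Filter.Tendsto (fun n : ℕ => (n.choose r : ℝ) / (n : ℝ) ^ r) Filter.atTop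
      (nhds (r.factorial : ℝ)⁻¹) := by
  have hne : ∀ᶠ n : ℕ in Filter.atTop, ((n : ℝ) ^ r / r.factorial) ≠ 0 := by
    filter_upwards [Filter.eventually_gt_atTop 0] with n hn
    positivity
  have h := (Asymptotics.isEquivalent_iff_tendsto_one hne).1 (isEquivalent_choose r)
  have h' := h.mul_const (r.factorial : ℝ)⁻¹
  rw [one_mul] at h'
  refine h'.congr fun n => ?_
  have := Nat.cast_ne_zero (R := ℝ).2 r.factorial_ne_zero
  simp only [Pi.div_apply]
  field_simp

/-- Existence of `π(P)`. -/
lemma exists_tendsto_exP_div_choose (hher : Hereditary P) (hne : ∀ n, (P n).Nonempty) :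
    ∃ L, Filter.Tendsto (fun n : ℕ => (exP P n : ℝ) / n.choose r) Filter.atTop (nhds L) :=
  exists_tendsto_of_succ_le r (fun _ => by positivity) fun _ hn =>
    exP_succ_div_choose_le hher hne hn

/-- Existence of `λ^(α)(P)`. -/
lemma exists_tendsto_lamP_mul_rpow {α : ℝ} (hα : 1 ≤ α) (hr : 0 < r) (hher : Hereditary P)
    (hne : ∀ n, (P n).Nonempty) :
    ∃ L, Filter.Tendsto (fun n : ℕ => lamP α P n * (n : ℝ) ^ ((r : ℝ) / α - r))
      Filter.atTop (nhds L) := by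
  have hα0 : 0 < α := by linarith
  obtain ⟨L, hL⟩ := exists_tendsto_of_succ_le
    (a := fun n => lamP α P n * (n : ℝ) ^ ((r : ℝ) / α) / n.choose r) r
    (fun n => by have := lamP_nonneg hα0 (hne n); positivity)
    fun _ hn => lamP_succ_mul_div_choose_le hα hr hher hne hn
  refine ⟨_, (hL.mul (tendsto_choose_div_pow r)).congr' ?_⟩
  filter_upwards [Filter.eventually_ge_atTop r] with n hn
  have hc : (n.choose r : ℝ) ≠ 0 := by exact_mod_cast (Nat.choose_pos hn).ne'
  have hn0 : (0 : ℝ) < n := by exact_mod_cast hr.trans_le hn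
  rw [Real.rpow_sub hn0, Real.rpow_natCast]
  field_simp

lemma tendsto_factorial_mul_exP_div_pow {L : ℝ}
    (hL : Filter.Tendsto (fun n : ℕ => (exP P n : ℝ) / n.choose r) Filter.atTop (nhds L)) :
    Filter.Tendsto (fun n : ℕ => (r.factorial : ℝ) * exP P n / (n : ℝ) ^ r)
      Filter.atTop (nhds L) := by
  have hf : (r.factorial : ℝ) ≠ 0 := Nat.cast_ne_zero.2 r.factorial_ne_zero
  have h := (hL.mul (tendsto_choose_div_pow r)).mul_const (r.factorial : ℝ)
  rw [mul_assoc, inv_mul_cancel₀ hf, mul_one] at h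
  refine h.congr' ?_
  filter_upwards [Filter.eventually_ge_atTop r] with n hn
  have hc : (n.choose r : ℝ) ≠ 0 := by exact_mod_cast (Nat.choose_pos hn).ne'
  field_simp

/-! ### Comparing different exponents -/

lemma polyform_rpow_le (G : HGraph r n) {p : ℝ} (hp : 1 ≤ p) {x : Fin n → ℝ}
    (hx : ∀ i, 0 ≤ x i) :
    G.polyform x ^ p ≤
      ((r.factorial : ℝ) * G.edges.card) ^ (p - 1) * G.polyform fun i => x i ^ p := by
  have hprod : ∀ e ∈ G.edges, 0 ≤ ∏ i ∈ e, x i := fun e _ => prod_nonneg fun i _ => hx i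
  have hf : (0 : ℝ) < r.factorial := by exact_mod_cast r.factorial_pos
  have hmean := Real.rpow_sum_le_const_mul_sum_rpow_of_nonneg G.edges hp hprod
  have hpow : ∀ e ∈ G.edges, (∏ i ∈ e, x i) ^ p = ∏ i ∈ e, x i ^ p := fun e _ =>
    (Real.finsetProd_rpow e x (fun i _ => hx i) p).symm
  rw [sum_congr rfl hpow] at hmean
  have hfp : (r.factorial : ℝ) ^ p = (r.factorial : ℝ) ^ (p - 1) * r.factorial := by
    rw [Real.rpow_sub_one hf.ne', div_mul_cancel₀ _ hf.ne']
  rw [polyform, polyform, Real.mul_rpow hf.le (sum_nonneg hprod),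
    Real.mul_rpow hf.le (Nat.cast_nonneg _), hfp]
  calc _ ≤ (r.factorial : ℝ) ^ (p - 1) * r.factorial *
        ((G.edges.card : ℝ) ^ (p - 1) * ∑ e ∈ G.edges, ∏ i ∈ e, x i ^ p) :=
        mul_le_mul_of_nonneg_left hmean (by positivity)
    _ = _ := by ring

lemma lam_rpow_le {α β : ℝ} (hα : 0 < α) (hαβ : α ≤ β) (hn : 0 < n) (G : HGraph r n) :
    lam β G ^ β ≤ lam α G ^ α * ((r.factorial : ℝ) * G.edges.card) ^ (β - α) := by
  have hβ : 0 < β := hα.trans_le hαβ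
  obtain ⟨x, hx, hsum, hlam⟩ := G.exists_polyform_eq_lam hβ hn
  have hsum' : ∑ i, |x i ^ (β / α)| ^ α = 1 := by
    rw [← hsum]
    refine sum_congr rfl fun i _ => ?_
    rw [abs_of_nonneg (Real.rpow_nonneg (hx i) _), ← Real.rpow_mul (hx i),
      div_mul_cancel₀ _ hα.ne']
  have hM : (0 : ℝ) ≤ (r.factorial : ℝ) * G.edges.card := by positivity
  have h1 : lam β G ^ (β / α) ≤
      ((r.factorial : ℝ) * G.edges.card) ^ (β / α - 1) * lam α G := by
    rw [← hlam]
    exact (G.polyform_rpow_le ((one_le_div hα).2 hαβ) hx).trans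
      (mul_le_mul_of_nonneg_left (G.polyform_le_lam hα hsum') (Real.rpow_nonneg hM _))
  have h2 := Real.rpow_le_rpow (Real.rpow_nonneg (lam_nonneg hβ G) _) h1 hα.le
  rw [← Real.rpow_mul (lam_nonneg hβ G), div_mul_cancel₀ _ hα.ne',
    Real.mul_rpow (Real.rpow_nonneg hM _) (lam_nonneg hα G), ← Real.rpow_mul hM, sub_mul,
    div_mul_cancel₀ _ hα.ne', one_mul, mul_comm] at h2
  exact h2

lemma lamP_rpow_le {α β : ℝ} (hα : 0 < α) (hαβ : α ≤ β) (hn : 0 < n) (hne : (P n).Nonempty) :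
    lamP β P n ^ β ≤ lamP α P n ^ α * ((r.factorial : ℝ) * exP P n) ^ (β - α) := by
  obtain ⟨G, hG, hlam⟩ := exists_lamP_eq_lam β hne
  rw [hlam]
  refine (G.lam_rpow_le hα hαβ hn).trans ?_
  have h1 := Real.rpow_le_rpow (lam_nonneg hα G) (lam_le_lamP α hG) hα.le
  have h2 : ((r.factorial : ℝ) * G.edges.card) ^ (β - α) ≤
      ((r.factorial : ℝ) * exP P n) ^ (β - α) := by
    refine Real.rpow_le_rpow (by positivity) ?_ (sub_nonneg.2 hαβ)
    exact mul_le_mul_of_nonneg_left (by exact_mod_cast card_edges_le_exP hG) (Nat.cast_nonneg _)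
  exact mul_le_mul h1 h2 (by positivity)
    (Real.rpow_nonneg (lamP_nonneg hα hne) _)

lemma lamP_mul_rpow_rpow_le {α β : ℝ} (hα : 0 < α) (hαβ : α ≤ β) (hn : 0 < n)
    (hne : (P n).Nonempty) :
    (lamP β P n * (n : ℝ) ^ ((r : ℝ) / β - r)) ^ β ≤
      (lamP α P n * (n : ℝ) ^ ((r : ℝ) / α - r)) ^ α *
        ((r.factorial : ℝ) * exP P n / (n : ℝ) ^ r) ^ (β - α) := by
  have hn0 : (0 : ℝ) < n := by exact_mod_cast hn
  have hβ : 0 < β := hα.trans_le hαβ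
  have hscale : ∀ γ : ℝ, 0 < γ → (lamP γ P n * (n : ℝ) ^ ((r : ℝ) / γ - r)) ^ γ =
      lamP γ P n ^ γ * (n : ℝ) ^ ((r : ℝ) - r * γ) := fun γ hγ => by
    rw [Real.mul_rpow (lamP_nonneg hγ hne) (Real.rpow_nonneg hn0.le _), ← Real.rpow_mul hn0.le,
      sub_mul, div_mul_cancel₀ _ hγ.ne']
  have hexp : (n : ℝ) ^ ((r : ℝ) - r * β) =
      (n : ℝ) ^ ((r : ℝ) - r * α) / ((n : ℝ) ^ r) ^ (β - α) := by
    rw [← Real.rpow_natCast, ← Real.rpow_mul hn0.le, ← Real.rpow_sub hn0]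
    congr 1
    ring
  rw [hscale β hβ, hscale α hα, Real.div_rpow (by positivity) (by positivity), hexp]
  calc _ ≤ lamP α P n ^ α * ((r.factorial : ℝ) * exP P n) ^ (β - α) *
        ((n : ℝ) ^ ((r : ℝ) - r * α) / ((n : ℝ) ^ r) ^ (β - α)) :=
        mul_le_mul_of_nonneg_right (lamP_rpow_le hα hαβ hn hne) (by positivity)
    _ = _ := by ring

end HGraph

open HGraph

/-- Proposition 7: for a hereditary property `P` of `r`-graphs and
`1 ≤ α ≤ β`, `(λ^(β)(P))^β ≤ (λ^(α)(P))^α · (π(P))^{β−α}`; in particular, if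
`π(P) > 0`, then `(λ^(β)(P)/π(P))^β ≤ (λ^(α)(P)/π(P))^α`. -/
theorem stmt11 {r : ℕ} (hr : 2 ≤ r)
    (P : ∀ n, Set (HGraph r n)) (hprop : IsProperty P) (hher : Hereditary P)
    (hne : ∀ n, (P n).Nonempty) (α β : ℝ) (hα : 1 ≤ α) (hαβ : α ≤ β) :
    ∃ Lα Lβ Lπ : ℝ,
      Filter.Tendsto (fun n : ℕ => lamP α P n * (n : ℝ) ^ ((r : ℝ) / α - r))
        Filter.atTop (nhds Lα) ∧
      Filter.Tendsto (fun n : ℕ => lamP β P n * (n : ℝ) ^ ((r : ℝ) / β - r))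
        Filter.atTop (nhds Lβ) ∧
      Filter.Tendsto (fun n : ℕ => (exP P n : ℝ) / (n.choose r : ℝ))
        Filter.atTop (nhds Lπ) ∧
      Lβ ^ β ≤ Lα ^ α * Lπ ^ (β - α) ∧
      (0 < Lπ → (Lβ / Lπ) ^ β ≤ (Lα / Lπ) ^ α) := by
  have hα0 : 0 < α := by linarith
  have hβ0 : 0 < β := by linarith
  have hr0 : 0 < r := by omega
  obtain ⟨Lα, hLα⟩ := exists_tendsto_lamP_mul_rpow hα hr0 hher hne
  obtain ⟨Lβ, hLβ⟩ := exists_tendsto_lamP_mul_rpow (hα.trans hαβ) hr0 hher hne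
  obtain ⟨Lπ, hLπ⟩ := exists_tendsto_exP_div_choose hher hne
  have hLα0 : 0 ≤ Lα := ge_of_tendsto' hLα fun n =>
    mul_nonneg (lamP_nonneg hα0 (hne n)) (by positivity)
  have hLβ0 : 0 ≤ Lβ := ge_of_tendsto' hLβ fun n =>
    mul_nonneg (lamP_nonneg hβ0 (hne n)) (by positivity)
  have hineq : Lβ ^ β ≤ Lα ^ α * Lπ ^ (β - α) := by
    refine le_of_tendsto_of_tendsto (hLβ.rpow_const (Or.inr hβ0.le))
      ((hLα.rpow_const (Or.inr hα0.le)).mul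
        ((tendsto_factorial_mul_exP_div_pow hLπ).rpow_const (Or.inr (sub_nonneg.2 hαβ)))) ?_
    filter_upwards [Filter.eventually_gt_atTop 0] with n hn
    exact lamP_mul_rpow_rpow_le hα0 hαβ hn (hne n)
  refine ⟨Lα, Lβ, Lπ, hLα, hLβ, hLπ, hineq, fun hpos => ?_⟩
  have hβ := Real.rpow_pos_of_pos hpos β
  rw [Real.div_rpow hLβ0 hpos.le, Real.div_rpow hLα0 hpos.le, div_le_iff₀ hβ]
  rw [Real.rpow_sub hpos] at hineq
  calc Lβ ^ β ≤ Lα ^ α * (Lπ ^ β / Lπ ^ α) := hineq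
    _ = Lα ^ α / Lπ ^ α * Lπ ^ β := by ring
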